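/- Consider an RLSLP (run-length straight-line program) G of size g representing a string X. Then (a) an LZ-like factorization of X with O(g) phrases can be obtained by a pre-order traversal that outputs, for each repeated symbol, a reference to the expansion of its first occurrence, and for each run-length rule A → B^k, one phrase for the first copy of exp(B) plus one previous-factor phrase of length (k−1)·|exp(B)|; in particular X admits an LZ-like factorization with O(g) phrases; and (b) for every fragment X[i..j], there exists an RLSLP of size O(g + h) representing X[i..j], where h is the height of G (hence of size O(g) when h = O(g)). -/

import Mathlib

open Classical

universe u

variable {α : Type u}

/-- The fragment `X[i..i+ℓ)` of a string (1-indexed, half-open). -/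
def frag (X : List α) (i ℓ : ℕ) : List α := (X.drop (i - 1)).take ℓ

/-- An LZ-like factorization of `X`: non-empty phrases whose concatenation is `X`, where
every phrase of length `> 1` is a previous factor at its position. -/
def IsLZLike (X : List α) (F : List (List α)) : Prop :=
  F.flatten = X ∧ (∀ p ∈ F, p ≠ []) ∧
  ∀ (a b : List (List α)) (p : List α), F = a ++ p :: b → 1 < p.length →
    ∃ i', 1 ≤ i' ∧ i' < a.flatten.length + 1 ∧ frag X i' p.length = p

/-- The right-hand side of a production of a run-length straight-line program with `g`
symbols: a terminal character, a pair of symbols, or a run-length power `B^k`. -/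
inductive Rhs (α : Type u) (g : ℕ) : Type u
  | terminal (a : α)
  | pair (i j : Fin g)
  | power (i : Fin g) (k : ℕ)

/-- A run-length straight-line program (RLSLP): symbols `Fin size`, each with a
production, topologically ordered so that productions use only smaller symbols, with
run-length exponents at least `2`, and a start symbol. -/
structure RLSLP (α : Type u) : Type u where
  size : ℕ
  rhs : Fin size → Rhs α size
  start : Fin size
  ord_pair : ∀ i j k, rhs i = Rhs.pair j k → j < i ∧ k < i
  ord_pow : ∀ i j m, rhs i = Rhs.power j m → j < i ∧ 2 ≤ m

/-- The expansion `exp(A)` of a symbol of an RLSLP. -/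
def RLSLP.exp (G : RLSLP α) (i : Fin G.size) : List α :=
  match h : G.rhs i with
  | Rhs.terminal a => [a]
  | Rhs.pair j k =>
      have hj : j < i := (G.ord_pair i j k h).1
      have hk : k < i := (G.ord_pair i j k h).2
      G.exp j ++ G.exp k
  | Rhs.power j m =>
      have hj : j < i := (G.ord_pow i j m h).1
      (List.replicate m (G.exp j)).flatten
termination_by i.1
decreasing_by
  · exact hj
  · exact hk
  · exact hj

/-- The height of (the parse tree of) a symbol of an RLSLP. -/
def RLSLP.height (G : RLSLP α) (i : Fin G.size) : ℕ :=
  match h : G.rhs i with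
  | Rhs.terminal _ => 0
  | Rhs.pair j k =>
      have hj : j < i := (G.ord_pair i j k h).1
      have hk : k < i := (G.ord_pair i j k h).2
      max (G.height j) (G.height k) + 1
  | Rhs.power j m =>
      have hj : j < i := (G.ord_pow i j m h).1
      G.height j + 1
termination_by i.1
decreasing_by
  · exact hj
  · exact hk
  · exact hj

namespace RLSLP

theorem exp_terminal (G : RLSLP α) {i : Fin G.size} {a : α} (h : G.rhs i = Rhs.terminal a) :
    G.exp i = [a] := by
  rw [RLSLP.exp]
  split <;> simp_all

theorem exp_pair (G : RLSLP α) {i j k : Fin G.size} (h : G.rhs i = Rhs.pair j k) :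
    G.exp i = G.exp j ++ G.exp k := by
  rw [RLSLP.exp]
  split <;> simp_all

theorem exp_power (G : RLSLP α) {i j : Fin G.size} {m : ℕ} (h : G.rhs i = Rhs.power j m) :
    G.exp i = (List.replicate m (G.exp j)).flatten := by
  rw [RLSLP.exp]
  split <;> simp_all

theorem height_pair (G : RLSLP α) {i j k : Fin G.size} (h : G.rhs i = Rhs.pair j k) :
    G.height i = max (G.height j) (G.height k) + 1 := by
  rw [RLSLP.height]
  split <;> simp_all

theorem height_power (G : RLSLP α) {i j : Fin G.size} {m : ℕ} (h : G.rhs i = Rhs.power j m) :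
    G.height i = G.height j + 1 := by
  rw [RLSLP.height]
  split <;> simp_all

/-- Structural induction along the productions of an RLSLP. -/
theorem symbol_induction (G : RLSLP α) {P : Fin G.size → Prop}
    (terminal : ∀ i a, G.rhs i = Rhs.terminal a → P i)
    (pair : ∀ i j k, G.rhs i = Rhs.pair j k → P j → P k → P i)
    (power : ∀ i j m, G.rhs i = Rhs.power j m → P j → P i) (i : Fin G.size) : P i := by
  induction i using WellFoundedLT.induction with
  | ind i ih =>
    cases h : G.rhs i with
    | terminal a => exact terminal i a h
    | pair j k =>
      exact pair i j k h (ih j (G.ord_pair i j k h).1) (ih k (G.ord_pair i j k h).2)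
    | power j m => exact power i j m h (ih j (G.ord_pow i j m h).1)

theorem exp_ne_nil (G : RLSLP α) (i : Fin G.size) : G.exp i ≠ [] := by
  induction i using G.symbol_induction with
  | terminal i a h => simp [G.exp_terminal h]
  | pair i j k h hj hk => simp [G.exp_pair h, hj]
  | power i j m h hj =>
    obtain ⟨n, rfl⟩ := Nat.exists_eq_add_of_le (G.ord_pow i j m h).2
    simp [G.exp_power h, Nat.add_comm 2 n, List.replicate_succ, hj]

end RLSLP

section LZ

/-- Appending a phrase that is a single character or has an earlier, possibly overlapping,
occurrence preserves LZ-like factorizations. -/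
theorem IsLZLike.append_phrase {X p : List α} {F : List (List α)} (hF : IsLZLike X F)
    (hp : p ≠ [])
    (hprev : 1 < p.length → ∃ u v : List α, X ++ p = u ++ p ++ v ∧ u.length < X.length) :
    IsLZLike (X ++ p) (F ++ [p]) := by
  obtain ⟨hX, hne, hlz⟩ := hF
  refine ⟨by simp [hX], ?_, ?_⟩
  · intro q hq
    rcases List.mem_append.1 hq with hq | hq
    · exact hne q hq
    · rw [List.mem_singleton.1 hq]
      exact hp
  · intro a b q hab hq
    rcases List.eq_nil_or_concat b with rfl | ⟨b', c, rfl⟩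
    · obtain ⟨rfl, hpq⟩ := List.append_inj' hab rfl
      obtain rfl : p = q := by simpa using hpq
      obtain ⟨u, v, huv, hu⟩ := hprev hq
      refine ⟨u.length + 1, by omega, by rw [hX]; omega, ?_⟩
      rw [huv]
      simp [frag]
    · have hab' : F ++ [p] = (a ++ q :: b') ++ [c] := by simpa using hab
      obtain ⟨i, hi, hia, hfrag⟩ := hlz a b' q (List.append_inj' hab' rfl).1 hq
      refine ⟨i, hi, hia, ?_⟩
      have hlen : q.length ≤ (X.drop (i - 1)).length := by
        have := congrArg List.length hfrag
        simp only [frag, List.length_take] at this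
        omega
      rw [frag, List.drop_append, List.take_append_of_le_length hlen]
      exact hfrag

/-- Visiting a symbol in the pre-order traversal: `S` is the set of symbols whose expansions
already occur in the factorized prefix `X`. -/
theorem RLSLP.exists_lz_step (G : RLSLP α) (A : Fin G.size) :
    ∀ (X : List α) (F : List (List α)) (S : Finset (Fin G.size)), IsLZLike X F →
      (∀ B ∈ S, G.exp B <:+: X) →
      ∃ (F' : List (List α)) (S' : Finset (Fin G.size)), IsLZLike (X ++ G.exp A) F' ∧
        (∀ B ∈ S', G.exp B <:+: X ++ G.exp A) ∧ S ⊆ S' ∧ (∀ B ∈ S', B ∈ S ∨ B ≤ A) ∧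
        F'.length + 2 * S.card ≤ F.length + 2 * S'.card + 1 := by
  have seen (A : Fin G.size) (X : List α) (F : List (List α)) (S : Finset (Fin G.size))
      (hF : IsLZLike X F) (hS : ∀ B ∈ S, G.exp B <:+: X) (hA : A ∈ S) :
      ∃ (F' : List (List α)) (S' : Finset (Fin G.size)), IsLZLike (X ++ G.exp A) F' ∧
        (∀ B ∈ S', G.exp B <:+: X ++ G.exp A) ∧ S ⊆ S' ∧ (∀ B ∈ S', B ∈ S ∨ B ≤ A) ∧
        F'.length + 2 * S.card ≤ F.length + 2 * S'.card + 1 := by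
    refine ⟨F ++ [G.exp A], S, hF.append_phrase (G.exp_ne_nil A) fun _ => ?_,
      fun B hB => (hS B hB).trans (List.infix_append' [] X _), subset_rfl, fun B hB => .inl hB,
      by simp; omega⟩
    obtain ⟨u, v, rfl⟩ := hS A hA
    have := List.length_pos_iff.2 (G.exp_ne_nil A)
    exact ⟨u, v ++ G.exp A, by simp, by simp; omega⟩
  induction A using G.symbol_induction with
  | terminal A a h =>
    intro X F S hF hS
    by_cases hA : A ∈ S
    · exact seen A X F S hF hS hA
    refine ⟨F ++ [G.exp A], insert A S, hF.append_phrase (G.exp_ne_nil A) fun hlen => ?_, ?_,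
      Finset.subset_insert A S, fun B hB => ?_, ?_⟩
    · simp [G.exp_terminal h] at hlen
    · intro B hB
      rcases Finset.mem_insert.1 hB with rfl | hB
      · exact (List.suffix_append X _).isInfix
      · exact (hS B hB).trans (List.prefix_append X _).isInfix
    · rcases Finset.mem_insert.1 hB with rfl | hB
      · exact .inr le_rfl
      · exact .inl hB
    · rw [Finset.card_insert_of_notMem hA]
      simp
      omega
  | pair A j k h ihj ihk =>
    intro X F S hF hS
    by_cases hA : A ∈ S
    · exact seen A X F S hF hS hA
    obtain ⟨hj, hk⟩ := G.ord_pair A j k h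
    obtain ⟨F₁, S₁, hF₁, hS₁, hSS₁, hle₁, hcard₁⟩ := ihj X F S hF hS
    obtain ⟨F₂, S₂, hF₂, hS₂, hSS₂, hle₂, hcard₂⟩ := ihk _ F₁ S₁ hF₁ hS₁
    have hle (B) (hB : B ∈ S₂) : B ∈ S ∨ B < A := by
      rcases hle₂ B hB with hB | hB
      · exact (hle₁ B hB).imp_right fun hB => hB.trans_lt hj
      · exact .inr (hB.trans_lt hk)
    have hA₂ : A ∉ S₂ := fun hA₂ => (hle A hA₂).elim hA (lt_irrefl A)
    rw [List.append_assoc, ← G.exp_pair h] at hF₂ hS₂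
    refine ⟨F₂, insert A S₂, hF₂, fun B hB => ?_,
      (hSS₁.trans hSS₂).trans (Finset.subset_insert A S₂), fun B hB => ?_, ?_⟩
    · rcases Finset.mem_insert.1 hB with rfl | hB
      · exact (List.suffix_append X _).isInfix
      · exact hS₂ B hB
    · rcases Finset.mem_insert.1 hB with rfl | hB
      · exact .inr le_rfl
      · exact (hle B hB).imp_right le_of_lt
    · rw [Finset.card_insert_of_notMem hA₂]
      omega
  | power A j m h ihj =>
    intro X F S hF hS
    by_cases hA : A ∈ S
    · exact seen A X F S hF hS hA
    obtain ⟨hj, hm⟩ := G.ord_pow A j m h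
    obtain ⟨F₁, S₁, hF₁, hS₁, hSS₁, hle₁, hcard₁⟩ := ihj X F S hF hS
    have hA₁ : A ∉ S₁ := fun hA₁ => (hle₁ A hA₁).elim hA fun hAj => absurd hj (not_lt.2 hAj)
    obtain ⟨n, rfl⟩ := Nat.exists_eq_add_of_le hm
    have hexp : G.exp A = G.exp j ++ (List.replicate (n + 1) (G.exp j)).flatten := by
      rw [G.exp_power h, show 2 + n = n + 1 + 1 by omega, List.replicate_succ, List.flatten_cons]
    have hexp' : G.exp A = (List.replicate (n + 1) (G.exp j)).flatten ++ G.exp j := by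
      rw [G.exp_power h, show 2 + n = n + 1 + 1 by omega, List.replicate_succ' (n := n + 1)]
      simp
    have hne := G.exp_ne_nil j
    have hF₂ := hF₁.append_phrase (p := (List.replicate (n + 1) (G.exp j)).flatten)
      (by simp [List.replicate_succ, hne]) fun _ =>
        ⟨X, G.exp j, by rw [List.append_assoc, ← hexp, hexp', List.append_assoc],
          by simpa [List.length_pos_iff] using hne⟩
    rw [List.append_assoc, ← hexp] at hF₂
    refine ⟨_, insert A S₁, hF₂, fun B hB => ?_, hSS₁.trans (Finset.subset_insert A S₁),
      fun B hB => ?_, ?_⟩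
    · rcases Finset.mem_insert.1 hB with rfl | hB
      · exact (List.suffix_append X _).isInfix
      · rw [hexp, ← List.append_assoc]
        exact (hS₁ B hB).trans (List.prefix_append _ _).isInfix
    · rcases Finset.mem_insert.1 hB with rfl | hB
      · exact .inr le_rfl
      · exact (hle₁ B hB).imp_right fun hB => (hB.trans_lt hj).le
    · rw [Finset.card_insert_of_notMem hA₁]
      simp
      omega

theorem RLSLP.exists_isLZLike (G : RLSLP α) :
    ∃ F : List (List α), IsLZLike (G.exp G.start) F ∧ F.length ≤ 2 * G.size + 1 := by
  obtain ⟨F, S, hF, -, -, -, hcard⟩ :=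
    G.exists_lz_step G.start [] [] ∅ ⟨rfl, by simp, by simp⟩ (by simp)
  have hS : S.card ≤ G.size := by simpa using S.card_le_univ
  refine ⟨F, hF, ?_⟩
  simp at hcard
  omega

end LZ

section Substring

/-- `w` is obtained from members of `L` by a single RLSLP production. -/
def IsProduced (L : List (List α)) (w : List α) : Prop :=
  (∃ a, w = [a]) ∨ (∃ x ∈ L, ∃ y ∈ L, w = x ++ y) ∨
    ∃ x ∈ L, ∃ m, 2 ≤ m ∧ w = (List.replicate m x).flatten

/-- Each member of `L` is obtained from the earlier ones by a single RLSLP production. -/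
def IsProgram (L : List (List α)) : Prop :=
  ∀ (i : ℕ) (hi : i < L.length), IsProduced (L.take i) L[i]

theorem IsProgram.append {L : List (List α)} {w : List α} (hL : IsProgram L)
    (hw : IsProduced L w) : IsProgram (L ++ [w]) := by
  intro i hi
  rcases Nat.lt_or_ge i L.length with hi' | hi'
  · rw [List.take_append_of_le_length hi'.le, List.getElem_append_left hi']
    exact hL i hi'
  · obtain rfl : i = L.length := by simp at hi; omega
    simpa using hw

theorem RLSLP.isProgram_ofFn_exp (G : RLSLP α) : IsProgram (List.ofFn G.exp) := by
  intro i hi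
  rw [List.length_ofFn] at hi
  have hmem (j : Fin G.size) (hj : j.1 < i) : G.exp j ∈ (List.ofFn G.exp).take i :=
    List.mem_take_iff_getElem.2 ⟨j, by simp [hj], by simp⟩
  rw [List.getElem_ofFn]
  cases h : G.rhs ⟨i, hi⟩ with
  | terminal a => exact .inl ⟨a, G.exp_terminal h⟩
  | pair j k =>
    obtain ⟨hj, hk⟩ := G.ord_pair _ j k h
    exact .inr (.inl ⟨_, hmem j hj, _, hmem k hk, G.exp_pair h⟩)
  | power j m =>
    obtain ⟨hj, hm⟩ := G.ord_pow _ j m h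
    exact .inr (.inr ⟨_, hmem j hj, m, hm, G.exp_power h⟩)

theorem IsProgram.exists_rlslp {L : List (List α)} (hL : IsProgram L) {w : List α}
    (hw : w ∈ L) : ∃ G : RLSLP α, G.exp G.start = w ∧ G.size = L.length := by
  have hrhs (i : Fin L.length) : ∃ r : Rhs α L.length,
      (∀ a, r = Rhs.terminal a → L[i] = [a]) ∧
      (∀ j k, r = Rhs.pair j k → (j < i ∧ k < i) ∧ L[i] = L[j] ++ L[k]) ∧
      (∀ j m, r = Rhs.power j m →
        (j < i ∧ 2 ≤ m) ∧ L[i] = (List.replicate m L[j]).flatten) := by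
    rcases hL i i.2 with ⟨a, ha⟩ | ⟨x, hx, y, hy, hxy⟩ | ⟨x, hx, m, hm, hxm⟩
    · refine ⟨.terminal a, ?_, by simp, by simp⟩
      rintro _ ⟨⟩
      exact ha
    · obtain ⟨j, hj, rfl⟩ := List.mem_take_iff_getElem.1 hx
      obtain ⟨k, hk, rfl⟩ := List.mem_take_iff_getElem.1 hy
      rw [lt_min_iff] at hj hk
      refine ⟨.pair ⟨j, hj.2⟩ ⟨k, hk.2⟩, by simp, ?_, by simp⟩
      rintro _ _ ⟨⟩
      exact ⟨⟨hj.1, hk.1⟩, hxy⟩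
    · obtain ⟨j, hj, rfl⟩ := List.mem_take_iff_getElem.1 hx
      rw [lt_min_iff] at hj
      refine ⟨.power ⟨j, hj.2⟩ m, by simp, by simp, ?_⟩
      rintro _ _ ⟨⟩
      exact ⟨⟨hj.1, hm⟩, hxm⟩
  choose rhs hterm hpair hpow using hrhs
  obtain ⟨s, hs, rfl⟩ := List.getElem_of_mem hw
  let G : RLSLP α :=
    { size := L.length
      rhs := rhs
      start := ⟨s, hs⟩
      ord_pair := fun i j k h => (hpair i j k h).1
      ord_pow := fun i j m h => (hpow i j m h).1 }
  have hexp (i : Fin G.size) : G.exp i = L[i.1]'i.2 := by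
    induction i using G.symbol_induction with
    | terminal i a h => exact (G.exp_terminal h).trans (hterm i a h).symm
    | pair i j k h hj hk =>
      rw [G.exp_pair h, hj, hk]
      exact (hpair i j k h).2.symm
    | power i j m h hj =>
      rw [G.exp_power h, hj]
      exact (hpow i j m h).2.symm
  exact ⟨G, hexp _, rfl⟩

/-- The program `L'` extends `L` by at most `c` further strings and computes `w`, where the
empty string counts as computed by any program. -/
def IsExtension (L : List (List α)) (c : ℕ) (w : List α) (L' : List (List α)) : Prop :=
  IsProgram L' ∧ L ⊆ L' ∧ L'.length ≤ L.length + c ∧ (w = [] ∨ w ∈ L')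

theorem IsProgram.isExtension {L : List (List α)} (hL : IsProgram L) {w : List α}
    (hw : w = [] ∨ w ∈ L) (c : ℕ) : IsExtension L c w L :=
  ⟨hL, List.Subset.refl L, Nat.le_add_right _ _, hw⟩

theorem IsExtension.mono {L L' : List (List α)} {c d : ℕ} {w : List α}
    (h : IsExtension L c w L') (hcd : c ≤ d) : IsExtension L d w L' :=
  ⟨h.1, h.2.1, by have := h.2.2.1; omega, h.2.2.2⟩

theorem IsExtension.trans {L L' L'' : List (List α)} {c d : ℕ} {w w' : List α}
    (h : IsExtension L c w L') (h' : IsExtension L' d w' L'') : IsExtension L (c + d) w' L'' :=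
  ⟨h'.1, List.Subset.trans h.2.1 h'.2.1, by have := h.2.2.1; have := h'.2.2.1; omega, h'.2.2.2⟩

theorem IsProgram.exists_isExtension_append {L : List (List α)} (hL : IsProgram L)
    {x y : List α} (hx : x = [] ∨ x ∈ L) (hy : y = [] ∨ y ∈ L) :
    ∃ L', IsExtension L 1 (x ++ y) L' := by
  rcases hx with rfl | hx
  · exact ⟨L, hL.isExtension (by simpa using hy) 1⟩
  rcases hy with rfl | hy
  · exact ⟨L, hL.isExtension (by simp [hx]) 1⟩
  exact ⟨L ++ [x ++ y], hL.append (.inr (.inl ⟨x, hx, y, hy, rfl⟩)),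
    List.subset_append_left _ _, by simp, by simp⟩

theorem IsProgram.exists_isExtension_replicate {L : List (List α)} (hL : IsProgram L)
    {x : List α} (hx : x ∈ L) (m : ℕ) :
    ∃ L', IsExtension L 1 (List.replicate m x).flatten L' := by
  rcases Nat.lt_or_ge m 2 with hm | hm
  · refine ⟨L, hL.isExtension ?_ 1⟩
    interval_cases m <;> simp [hx]
  · exact ⟨L ++ [(List.replicate m x).flatten], hL.append (.inr (.inr ⟨x, hx, m, hm, rfl⟩)),
      List.subset_append_left _ _, by simp, by simp⟩

theorem exists_take_flatten_replicate (x : List α) (m n : ℕ) : ∃ q r,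
    (List.replicate m x).flatten.take n = (List.replicate q x).flatten ++ x.take r := by
  induction m generalizing n with
  | zero => exact ⟨0, 0, by simp⟩
  | succ m ih =>
    rw [List.replicate_succ, List.flatten_cons, List.take_append]
    rcases Nat.le_total n x.length with hn | hn
    · exact ⟨0, n, by simp [Nat.sub_eq_zero_of_le hn]⟩
    · obtain ⟨q, r, h⟩ := ih (n - x.length)
      exact ⟨q + 1, r, by rw [h, List.take_of_length_le hn]; simp [List.replicate_succ]⟩

theorem exists_drop_flatten_replicate (x : List α) (m n : ℕ) : ∃ q r,
    (List.replicate m x).flatten.drop n = x.drop r ++ (List.replicate q x).flatten := by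
  induction m generalizing n with
  | zero => exact ⟨0, x.length, by simp⟩
  | succ m ih =>
    rw [List.replicate_succ, List.flatten_cons, List.drop_append]
    rcases Nat.le_total n x.length with hn | hn
    · exact ⟨m, n, by simp [Nat.sub_eq_zero_of_le hn]⟩
    · obtain ⟨q, r, h⟩ := ih (n - x.length)
      exact ⟨q, r, by rw [h, List.drop_of_length_le hn]; simp⟩

theorem RLSLP.exists_isExtension_take (G : RLSLP α) (A : Fin G.size) :
    ∀ (L : List (List α)) (n : ℕ), IsProgram L → (∀ B, G.exp B ∈ L) →
      ∃ L', IsExtension L (2 * G.height A) ((G.exp A).take n) L' := by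
  induction A using G.symbol_induction with
  | terminal A a h =>
    intro L n hL hG
    refine ⟨L, hL.isExtension ?_ _⟩
    have := hG A
    rw [G.exp_terminal h] at this ⊢
    cases n <;> simp [this]
  | pair A j k h ihj ihk =>
    intro L n hL hG
    have hmax := G.height_pair h
    rw [G.exp_pair h, List.take_append]
    rcases Nat.le_total n (G.exp j).length with hn | hn
    · obtain ⟨L₁, h₁⟩ := ihj L n hL hG
      rw [Nat.sub_eq_zero_of_le hn, List.take_zero, List.append_nil]
      exact ⟨L₁, h₁.mono (by omega)⟩
    · rw [List.take_of_length_le hn]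
      obtain ⟨L₁, h₁⟩ := ihk L (n - (G.exp j).length) hL hG
      obtain ⟨L₂, h₂⟩ := h₁.1.exists_isExtension_append (.inr (h₁.2.1 (hG j))) h₁.2.2.2
      exact ⟨L₂, (h₁.trans h₂).mono (by omega)⟩
  | power A j m h ihj =>
    intro L n hL hG
    have hmax := G.height_power h
    obtain ⟨q, r, hqr⟩ := exists_take_flatten_replicate (G.exp j) m n
    rw [G.exp_power h, hqr]
    obtain ⟨L₁, h₁⟩ := ihj L r hL hG
    obtain ⟨L₂, h₂⟩ := h₁.1.exists_isExtension_replicate (h₁.2.1 (hG j)) q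
    obtain ⟨L₃, h₃⟩ := h₂.1.exists_isExtension_append h₂.2.2.2
      (h₁.2.2.2.imp_right fun hw => h₂.2.1 hw)
    exact ⟨L₃, ((h₁.trans h₂).trans h₃).mono (by omega)⟩

theorem RLSLP.exists_isExtension_drop (G : RLSLP α) (A : Fin G.size) :
    ∀ (L : List (List α)) (n : ℕ), IsProgram L → (∀ B, G.exp B ∈ L) →
      ∃ L', IsExtension L (2 * G.height A) ((G.exp A).drop n) L' := by
  induction A using G.symbol_induction with
  | terminal A a h =>
    intro L n hL hG
    refine ⟨L, hL.isExtension ?_ _⟩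
    have := hG A
    rw [G.exp_terminal h] at this ⊢
    cases n <;> simp [this]
  | pair A j k h ihj ihk =>
    intro L n hL hG
    have hmax := G.height_pair h
    rw [G.exp_pair h, List.drop_append]
    rcases Nat.le_total n (G.exp j).length with hn | hn
    · obtain ⟨L₁, h₁⟩ := ihj L n hL hG
      rw [Nat.sub_eq_zero_of_le hn, List.drop_zero]
      obtain ⟨L₂, h₂⟩ := h₁.1.exists_isExtension_append h₁.2.2.2 (.inr (h₁.2.1 (hG k)))
      exact ⟨L₂, (h₁.trans h₂).mono (by omega)⟩
    · rw [List.drop_of_length_le hn, List.nil_append]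
      obtain ⟨L₁, h₁⟩ := ihk L (n - (G.exp j).length) hL hG
      exact ⟨L₁, h₁.mono (by omega)⟩
  | power A j m h ihj =>
    intro L n hL hG
    have hmax := G.height_power h
    obtain ⟨q, r, hqr⟩ := exists_drop_flatten_replicate (G.exp j) m n
    rw [G.exp_power h, hqr]
    obtain ⟨L₁, h₁⟩ := ihj L r hL hG
    obtain ⟨L₂, h₂⟩ := h₁.1.exists_isExtension_replicate (h₁.2.1 (hG j)) q
    obtain ⟨L₃, h₃⟩ := h₂.1.exists_isExtension_append
      (h₁.2.2.2.imp_right fun hw => h₂.2.1 hw) h₂.2.2.2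
    exact ⟨L₃, ((h₁.trans h₂).trans h₃).mono (by omega)⟩

theorem RLSLP.exists_isExtension_take_drop (G : RLSLP α) (A : Fin G.size) :
    ∀ (L : List (List α)) (d n : ℕ), IsProgram L → (∀ B, G.exp B ∈ L) →
      ∃ L', IsExtension L (4 * G.height A) (((G.exp A).drop d).take n) L' := by
  induction A using G.symbol_induction with
  | terminal A a h =>
    intro L d n hL hG
    refine ⟨L, hL.isExtension ?_ _⟩
    have := hG A
    rw [G.exp_terminal h] at this ⊢
    cases d <;> cases n <;> simp [this]
  | pair A j k h ihj ihk =>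
    intro L d n hL hG
    have hmax := G.height_pair h
    rw [G.exp_pair h, List.drop_append]
    rcases Nat.le_total (G.exp j).length d with hd | hd
    · rw [List.drop_of_length_le hd, List.nil_append]
      obtain ⟨L₁, h₁⟩ := ihk L (d - (G.exp j).length) n hL hG
      exact ⟨L₁, h₁.mono (by omega)⟩
    rw [Nat.sub_eq_zero_of_le hd, List.drop_zero, List.take_append]
    rcases Nat.le_total n ((G.exp j).drop d).length with hn | hn
    · rw [Nat.sub_eq_zero_of_le hn, List.take_zero, List.append_nil]
      obtain ⟨L₁, h₁⟩ := ihj L d n hL hG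
      exact ⟨L₁, h₁.mono (by omega)⟩
    · rw [List.take_of_length_le hn]
      obtain ⟨L₁, h₁⟩ := G.exists_isExtension_drop j L d hL hG
      obtain ⟨L₂, h₂⟩ := G.exists_isExtension_take k L₁ (n - ((G.exp j).drop d).length) h₁.1
        fun B => h₁.2.1 (hG B)
      obtain ⟨L₃, h₃⟩ := h₂.1.exists_isExtension_append
        (h₁.2.2.2.imp_right fun hw => h₂.2.1 hw) h₂.2.2.2
      exact ⟨L₃, ((h₁.trans h₂).trans h₃).mono (by omega)⟩
  | power A j m h ihj =>
    intro L d n hL hG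
    have hmax := G.height_power h
    obtain ⟨q, r, hqr⟩ := exists_drop_flatten_replicate (G.exp j) m d
    rw [G.exp_power h, hqr, List.take_append]
    rcases Nat.le_total n ((G.exp j).drop r).length with hn | hn
    · rw [Nat.sub_eq_zero_of_le hn, List.take_zero, List.append_nil]
      obtain ⟨L₁, h₁⟩ := ihj L r n hL hG
      exact ⟨L₁, h₁.mono (by omega)⟩
    · obtain ⟨s, t, hst⟩ :=
        exists_take_flatten_replicate (G.exp j) q (n - ((G.exp j).drop r).length)
      rw [List.take_of_length_le hn, hst]
      obtain ⟨L₁, h₁⟩ := G.exists_isExtension_drop j L r hL hG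
      obtain ⟨L₂, h₂⟩ := G.exists_isExtension_take j L₁ t h₁.1 fun B => h₁.2.1 (hG B)
      obtain ⟨L₃, h₃⟩ := h₂.1.exists_isExtension_replicate (h₂.2.1 (h₁.2.1 (hG j))) s
      obtain ⟨L₄, h₄⟩ := h₃.1.exists_isExtension_append h₃.2.2.2
        (h₂.2.2.2.imp_right fun hw => h₃.2.1 hw)
      obtain ⟨L₅, h₅⟩ := h₄.1.exists_isExtension_append
        (h₁.2.2.2.imp_right fun hw => h₄.2.1 (h₃.2.1 (h₂.2.1 hw))) h₄.2.2.2
      exact ⟨L₅, ((((h₁.trans h₂).trans h₃).trans h₄).trans h₅).mono (by omega)⟩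

theorem RLSLP.exists_rlslp_take_drop (G : RLSLP α) (d n : ℕ)
    (hne : ((G.exp G.start).drop d).take n ≠ []) :
    ∃ G' : RLSLP α, G'.exp G'.start = ((G.exp G.start).drop d).take n ∧
      G'.size ≤ G.size + 4 * G.height G.start := by
  obtain ⟨L, hL, -, hlen, hw⟩ := G.exists_isExtension_take_drop G.start (List.ofFn G.exp) d n
    G.isProgram_ofFn_exp fun B => List.mem_ofFn.2 ⟨B, rfl⟩
  obtain ⟨G', hG', hsize⟩ := hL.exists_rlslp (hw.resolve_left hne)
  refine ⟨G', hG', ?_⟩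
  rwa [hsize, ← List.length_ofFn (f := G.exp)]

end Substring

/-- There is a universal constant `C` such that for every RLSLP `G` of
size `g` representing a string `X`: (a) `X` admits an LZ-like factorization with at most
`C·g` phrases; and (b) for every fragment `X[i..j]` there exists an RLSLP representing
`X[i..j]` of size at most `C·(g + h)`, where `h` is the height of `G`. -/
theorem rlslp_lz_and_substring : ∃ C : ℕ, ∀ {β : Type u} (G : RLSLP β) (X : List β),
    G.exp G.start = X →
    (∃ F : List (List β), IsLZLike X F ∧ F.length ≤ C * G.size) ∧
    (∀ i j : ℕ, 1 ≤ i → i ≤ j → j ≤ X.length →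
      ∃ G' : RLSLP β, G'.exp G'.start = frag X i (j - i + 1) ∧
        G'.size ≤ C * (G.size + G.height G.start)) := by
  refine ⟨4, ?_⟩
  rintro β G X rfl
  refine ⟨?_, fun i j hi hij hj => ?_⟩
  · obtain ⟨F, hF, hlen⟩ := G.exists_isLZLike
    have := G.start.pos
    exact ⟨F, hF, by omega⟩
  · obtain ⟨G', hG', hsize⟩ := G.exists_rlslp_take_drop (i - 1) (j - i + 1) (by
      rw [← List.length_pos_iff]
      simp
      omega)
    exact ⟨G', hG', by omega⟩
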